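/- Let I be a finite index set. For each i ∈ I, let Y_i be a uniformly convex Banach space and X_i ⊆ Y_i nonempty, closed, and convex. Suppose for each i: (a) u_i : Y_{-i} × Y_i → ℝ is upper semicontinuous and quasi-concave in its second argument; (b) F_i : X_{-i} → 2^{Y_i} is upper semicontinuous with nonempty, closed, convex values and the closure of F_i(X_{-i}) is compact; (c) u_i is feasible path transfer lower semicontinuous in x_{-i} with respect to F_i. Then the GNEP(F_i, u_i) admits a best approximate solution: there exist x̃ ∈ ∏_i X_i and ỹ ∈ ∏_i Y_i such that ‖ỹ_i - x̃_i‖ = inf_{x_i ∈ X_i} ‖ỹ_i - x_i‖ and u_i(x̃_{-i}, ỹ_i) ≥ u_i(x̃_{-i}, z_i) for all z_i ∈ F_i(x̃_{-i}), for every i. -/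

import Mathlib

open Filter Topology Set

/-- The set of feasible strategy profiles `∏ᵢ Xᵢ`, viewed inside `∏ᵢ Yᵢ`. -/
def profileSet {ι : Type*} {Y : ι → Type*} (X : ∀ i, Set (Y i)) : Set (∀ j, Y j) :=
  {w | ∀ j, w j ∈ X j}

namespace ScarfLemma

section
variable {T I : Type*} [DecidableEq T] [DecidableEq I]

/-- Scarf dominance. -/
def Dom (r : I → T → ℕ) (σ : Finset T) (C : Finset I) : Prop :=
  ∀ y, ∃ i ∈ C, ∀ x ∈ σ, r i y ≤ r i x

/-- A door `d` of a room `ρ`. -/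
def Inc (d ρ : Finset T × Finset I) : Prop :=
  (∃ x, x ∉ d.1 ∧ ρ = (insert x d.1, d.2)) ∨ (∃ i, i ∈ d.2 ∧ ρ = (d.1, d.2.erase i))

def Room (r : I → T → ℕ) (ρ : Finset T × Finset I) : Prop :=
  Dom r ρ.1 ρ.2 ∧ ρ.1.card = ρ.2.card

def Door (r : I → T → ℕ) (c : T → I) (i0 : I) (d : Finset T × Finset I) : Prop :=
  Dom r d.1 d.2 ∧ i0 ∈ d.2 ∧ d.1.image c = d.2.erase i0 ∧ d.1.card + 1 = d.2.card

/-- The candidate rooms next to a door. -/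
def Nxt (r : I → T → ℕ) (σ : Finset T) (C : Finset I) (m : I → T) (i : I)
    (ρ : Finset T × Finset I) : Prop :=
  ((∀ y, ¬ ∀ j ∈ C.erase i, r j (m j) < r j y) ∧ ρ = (σ, C.erase i)) ∨
  (∃ x, (∀ j ∈ C.erase i, r j (m j) < r j x) ∧
    (∀ y, (∀ j ∈ C.erase i, r j (m j) < r j y) → r i y ≤ r i x) ∧ ρ = (insert x σ, C))

theorem nxt_unique [Finite T] (r : I → T → ℕ) (hr : ∀ i, Function.Injective (r i))
    (σ : Finset T) (C : Finset I) (m : I → T) (i : I) : ∃ ρ, ∀ ρ', Nxt r σ C m i ρ' ↔ ρ' = ρ := by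
  by_cases h : ∀ y, ¬ ∀ j ∈ C.erase i, r j (m j) < r j y
  · refine ⟨(σ, C.erase i), fun ρ' => ⟨?_, fun e => Or.inl ⟨h, e⟩⟩⟩
    rintro (⟨_, e⟩ | ⟨x, hx, _⟩)
    · exact e
    · exact absurd hx (h x)
  · have hne : {y | ∀ j ∈ C.erase i, r j (m j) < r j y}.Nonempty := by
      by_contra h'
      rw [Set.not_nonempty_iff_eq_empty, Set.eq_empty_iff_forall_notMem] at h'
      exact h h'
    obtain ⟨x, hx, hmax⟩ := Set.exists_max_image _ (r i) (Set.toFinite _) hne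
    refine ⟨(insert x σ, C), fun ρ' => ⟨?_, fun e => Or.inr ⟨x, hx, hmax, e⟩⟩⟩
    rintro (⟨h', e⟩ | ⟨x', hx', hmax', e⟩)
    · exact absurd h' h
    · have : x' = x := hr i (le_antisymm (hmax x' hx') (hmax' x hx))
      rw [e, this]

theorem door_two [Finite T] (r : I → T → ℕ) (hr : ∀ i, Function.Injective (r i))
    (σ : Finset T) (C : Finset I) (hσ : σ.Nonempty) (hD : Dom r σ C) (hc : σ.card + 1 = C.card) :
    ∃ ρ₁ ρ₂, ρ₁ ≠ ρ₂ ∧ ∀ ρ, (Room r ρ ∧ Inc (σ, C) ρ) ↔ (ρ = ρ₁ ∨ ρ = ρ₂) := by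
  have hm : ∀ i, ∃ x ∈ σ, ∀ y ∈ σ, r i x ≤ r i y := fun i => σ.exists_min_image (r i) hσ
  choose m hmσ hmin using hm
  -- a collision
  obtain ⟨i1, h1, i2, h2, h12, hm12⟩ : ∃ i1 ∈ C, ∃ i2 ∈ C, i1 ≠ i2 ∧ m i1 = m i2 :=
    Finset.exists_ne_map_eq_of_card_lt_of_maps_to (by omega) (fun i _ => hmσ i)
  have hsurj : ∀ τ : Finset T, ∀ C' : Finset I, Dom r τ C' → ∀ x ∈ τ, ∃ i ∈ C',
      ∀ y ∈ τ, r i x ≤ r i y := fun τ C' h x _ => h x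
  have hms : ∀ x ∈ σ, ∃ i ∈ C, m i = x := by
    intro x hx
    obtain ⟨i, hi, h⟩ := hD x
    exact ⟨i, hi, hr i (le_antisymm (hmin i x hx) (h _ (hmσ i)))⟩
  have inj_of : ∀ i ∈ C, (∀ x ∈ σ, ∃ j ∈ C.erase i, m j = x) →
      Set.InjOn m (C.erase i : Finset I) := by
    intro i hi h
    have himg : (C.erase i).image m = σ := by
      ext x
      simp only [Finset.mem_image]
      constructor
      · rintro ⟨j, _, rfl⟩
        exact hmσ j
      · exact h x
    rw [← Finset.card_image_iff, himg, Finset.card_erase_of_mem hi]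
    omega
  have hs1 : ∀ x ∈ σ, ∃ j ∈ C.erase i1, m j = x := by
    intro x hx
    obtain ⟨i, hi, e⟩ := hms x hx
    by_cases h : i = i1
    · exact ⟨i2, Finset.mem_erase.2 ⟨h12.symm, h2⟩, by rw [← hm12, ← h, e]⟩
    · exact ⟨i, Finset.mem_erase.2 ⟨h, hi⟩, e⟩
  have hs2 : ∀ x ∈ σ, ∃ j ∈ C.erase i2, m j = x := by
    intro x hx
    obtain ⟨i, hi, e⟩ := hms x hx
    by_cases h : i = i2
    · exact ⟨i1, Finset.mem_erase.2 ⟨h12, h1⟩, by rw [hm12, ← h, e]⟩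
    · exact ⟨i, Finset.mem_erase.2 ⟨h, hi⟩, e⟩
  -- if `m` is injective away from `i`, then `i` is `i1` or `i2`
  have honly : ∀ i ∈ C, Set.InjOn m (C.erase i : Finset I) → i = i1 ∨ i = i2 := by
    intro i hi hinj
    by_contra! hne
    exact h12 (hinj (by simp [h1, hne.1.symm]) (by simp [h2, hne.2.symm]) hm12)
  -- rooms are next
  have hroom : ∀ ρ, (Room r ρ ∧ Inc (σ, C) ρ) → ∃ i ∈ C, (i = i1 ∨ i = i2) ∧ Nxt r σ C m i ρ := by
    rintro ρ ⟨⟨hdom, hcard⟩, ⟨x, hx, rfl⟩ | ⟨i, hi, rfl⟩⟩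
    · simp only at hx hdom hcard
      -- every element of insert x σ is a strict min
      obtain ⟨i, hi, hix⟩ := hdom x
      have hdommin : ∀ z ∈ σ, ∃ j ∈ C, j ≠ i ∧ r j z < r j x ∧ m j = z := by
        intro z hz
        obtain ⟨j, hj, hjz⟩ := hdom z
        have hne : z ≠ x := fun e => hx (e ▸ hz)
        have hlt : r j z < r j x :=
          lt_of_le_of_ne (hjz x (Finset.mem_insert_self _ _)) (fun e => hne (hr j e))
        refine ⟨j, hj, ?_, hlt, hr j (le_antisymm (hmin j z hz)
          (hjz _ (Finset.mem_insert_of_mem (hmσ j))))⟩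
        rintro rfl
        exact absurd (hix z (Finset.mem_insert_of_mem hz)) (not_le.2 hlt)
      have hinj : Set.InjOn m (C.erase i : Finset I) := by
        apply inj_of i hi
        intro z hz
        obtain ⟨j, hj, hji, _, e⟩ := hdommin z hz
        exact ⟨j, Finset.mem_erase.2 ⟨hji, hj⟩, e⟩
      refine ⟨i, hi, honly i hi hinj, Or.inr ⟨x, ?_, ?_, rfl⟩⟩
      · intro j hj
        obtain ⟨k, hk, hki, hlt, e⟩ := hdommin (m j) (hmσ j)
        have : k = j := hinj (by simp [hk, hki]) hj e
        subst this
        exact hlt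
      · intro y hy
        obtain ⟨j, hj, hjy⟩ := hdom y
        by_cases hji : j = i
        · subst hji
          exact hjy x (Finset.mem_insert_self _ _)
        · have h3 := hy j (Finset.mem_erase.2 ⟨hji, hj⟩)
          exact absurd (hjy _ (Finset.mem_insert_of_mem (hmσ j))) (not_le.2 h3)
    · simp only at hi hdom hcard
      refine ⟨i, hi, ?_, Or.inl ⟨?_, rfl⟩⟩
      · apply honly i hi
        apply inj_of i hi
        intro x hx
        obtain ⟨j, hj, h⟩ := hdom x
        exact ⟨j, hj, hr j (le_antisymm (hmin j x hx) (h _ (hmσ j)))⟩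
      · intro y hy
        obtain ⟨j, hj, h⟩ := hdom y
        exact absurd (h _ (hmσ j)) (not_le.2 (hy j hj))
  have hback : ∀ i ∈ C, (∀ x ∈ σ, ∃ j ∈ C.erase i, m j = x) → ∀ ρ, Nxt r σ C m i ρ →
      (Room r ρ ∧ Inc (σ, C) ρ) := by
    rintro i hi hs ρ (⟨hE, rfl⟩ | ⟨x, hx, hmax, rfl⟩)
    · refine ⟨⟨?_, ?_⟩, Or.inr ⟨i, hi, rfl⟩⟩
      · intro y
        have := hE y
        push Not at this
        obtain ⟨j, hj, h⟩ := this
        exact ⟨j, hj, fun z hz => h.trans (hmin j z hz)⟩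
      · simp only [Finset.card_erase_of_mem hi]
        omega
    · have hxσ : x ∉ σ := by
        intro h
        obtain ⟨j, hj, e⟩ := hs x h
        have := hx j hj
        rw [e] at this
        exact lt_irrefl _ this
      refine ⟨⟨?_, ?_⟩, Or.inl ⟨x, hxσ, rfl⟩⟩
      · intro y
        by_cases hy : ∀ j ∈ C.erase i, r j (m j) < r j y
        · refine ⟨i, hi, fun z hz => ?_⟩
          have hyx := hmax y hy
          rcases Finset.mem_insert.1 hz with rfl | hz
          · exact hyx
          · obtain ⟨k, hk, h⟩ := hD x
            by_cases hki : k = i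
            · subst hki
              exact hyx.trans (h z hz)
            · exact absurd (h _ (hmσ k)) (not_le.2 (hx k (Finset.mem_erase.2 ⟨hki, hk⟩)))
        · push Not at hy
          obtain ⟨j, hj, h⟩ := hy
          refine ⟨j, (Finset.mem_erase.1 hj).2, fun z hz => ?_⟩
          rcases Finset.mem_insert.1 hz with rfl | hz
          · exact h.trans (hx j hj).le
          · exact h.trans (hmin j z hz)
      · simp only [Finset.card_insert_of_notMem hxσ]
        omega
  obtain ⟨ρ₁, hρ₁⟩ := nxt_unique r hr σ C m i1
  obtain ⟨ρ₂, hρ₂⟩ := nxt_unique r hr σ C m i2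
  refine ⟨ρ₁, ρ₂, ?_, fun ρ => ⟨fun h => ?_, ?_⟩⟩
  · intro e
    have n1 := (hρ₁ ρ₁).2 rfl
    have n2 := (hρ₂ ρ₁).2 e
    rcases n1 with ⟨_, e1⟩ | ⟨x, hx, _, e1⟩ <;> rcases n2 with ⟨_, e2⟩ | ⟨x', hx', _, e2⟩
    · rw [e1] at e2
      have e3 : C.erase i1 = C.erase i2 := congrArg Prod.snd e2
      have : i2 ∈ C.erase i1 := Finset.mem_erase.2 ⟨h12.symm, h2⟩
      rw [e3] at this
      simp at this
    · rw [e1] at e2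
      have e3 : C.erase i1 = C := congrArg Prod.snd e2
      rw [← e3] at h1
      simp at h1
    · rw [e1] at e2
      have e3 : C = C.erase i2 := congrArg Prod.snd e2
      rw [e3] at h2
      simp at h2
    · rw [e1] at e2
      have e3 : insert x σ = insert x' σ := congrArg Prod.fst e2
      have hxσ : x ∉ σ := by
        intro h
        obtain ⟨j, hj, e⟩ := hs1 x h
        have := hx j hj
        rw [e] at this
        exact lt_irrefl _ this
      have hxx : x = x' := by
        have : x ∈ insert x' σ := e3 ▸ Finset.mem_insert_self x σ
        rcases Finset.mem_insert.1 this with h | h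
        · exact h
        · exact absurd h hxσ
      subst hxx
      obtain ⟨k, hk, h⟩ := hD x
      by_cases hk1 : k = i1
      · exact absurd (h _ (hmσ k)) (not_le.2 (hx' k (Finset.mem_erase.2 ⟨hk1 ▸ h12, hk⟩)))
      · exact absurd (h _ (hmσ k)) (not_le.2 (hx k (Finset.mem_erase.2 ⟨hk1, hk⟩)))
  · obtain ⟨i, hi, h', hn⟩ := hroom ρ h
    rcases h' with rfl | rfl
    · exact Or.inl ((hρ₁ ρ).1 hn)
    · exact Or.inr ((hρ₂ ρ).1 hn)
  · rintro (h | h)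
    · exact hback i1 h1 hs1 ρ ((hρ₁ ρ).2 h)
    · exact hback i2 h2 hs2 ρ ((hρ₂ ρ).2 h)

/-- The outside door has one room. -/
theorem door_one [Finite T] [Nonempty T] (r : I → T → ℕ) (hr : ∀ i, Function.Injective (r i))
    (i0 : I) : ∃ ρ₁, ∀ ρ, (Room r ρ ∧ Inc ((∅ : Finset T), ({i0} : Finset I)) ρ) ↔ ρ = ρ₁ := by
  obtain ⟨x, -, hx⟩ := Set.exists_max_image (Set.univ : Set T) (r i0) (Set.toFinite _)
    Set.univ_nonempty
  refine ⟨({x}, {i0}), fun ρ => ⟨?_, ?_⟩⟩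
  · rintro ⟨⟨hdom, hcard⟩, ⟨z, hz, rfl⟩ | ⟨i, hi, rfl⟩⟩
    · obtain ⟨j, hj, h⟩ := hdom x
      simp only [Finset.mem_singleton] at hj
      subst hj
      have h1 := h z (Finset.mem_insert_self _ _)
      have : x = z := hr j (le_antisymm h1 (hx z (Set.mem_univ _)))
      subst this
      rfl
    · simp only [Finset.mem_singleton] at hi
      subst hi
      obtain ⟨j, hj, h⟩ := hdom x
      simp at hj
  · rintro rfl
    refine ⟨⟨?_, by simp⟩, Or.inl ⟨x, by simp, by simp⟩⟩
    intro y
    exact ⟨i0, by simp, by simpa using hx y (Set.mem_univ _)⟩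

/-- Rooms that are not colourful have an even number of doors. -/
theorem room_even (r : I → T → ℕ) (c : T → I) (i0 : I) (ρ : Finset T × Finset I)
    (hρ : Room r ρ) (hcol : ρ.1.image c ≠ ρ.2) :
    (∀ d, ¬ (Door r c i0 d ∧ Inc d ρ)) ∨
    ∃ d₁ d₂, d₁ ≠ d₂ ∧ ∀ d, (Door r c i0 d ∧ Inc d ρ) ↔ (d = d₁ ∨ d = d₂) := by
  obtain ⟨σ, C⟩ := ρ
  obtain ⟨hdom, hcard⟩ := hρ
  simp only at hdom hcard hcol
  have key : ∀ d, (Door r c i0 d ∧ Inc d (σ, C)) ↔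
      ((∃ x ∈ σ, i0 ∈ C ∧ (σ.erase x).image c = C.erase i0 ∧ d = (σ.erase x, C)) ∨
       (∃ i, i ∉ C ∧ i0 ∈ C ∧ i ≠ i0 ∧ σ.image c = insert i (C.erase i0) ∧
          d = (σ, insert i C))) := by
    rintro ⟨τ, D⟩
    constructor
    · rintro ⟨⟨hd, hi0, himg, hcd⟩, ⟨x, hx, e⟩ | ⟨i, hi, e⟩⟩
      · simp only [Prod.mk.injEq] at e hi0 himg hx
        obtain ⟨rfl, rfl⟩ := e
        refine Or.inl ⟨x, Finset.mem_insert_self _ _, hi0, ?_, ?_⟩ <;>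
          rw [Finset.erase_insert hx]
        exact himg
      · simp only [Prod.mk.injEq] at e hi0 himg hi
        obtain ⟨rfl, rfl⟩ := e
        by_cases h : i = i0
        · subst h
          exact absurd himg hcol
        · refine Or.inr ⟨i, by simp, by simp [Ne.symm h, hi0], h, ?_, ?_⟩
          · rw [himg, Finset.erase_right_comm, Finset.insert_erase]
            exact Finset.mem_erase.2 ⟨h, hi⟩
          · rw [Finset.insert_erase hi]
    · rintro (⟨x, hx, hi0, himg, e⟩ | ⟨i, hi, hi0, hii, himg, e⟩)
      · rw [e]
        refine ⟨⟨?_, hi0, himg, ?_⟩, Or.inl ⟨x, by simp, by simp [Finset.insert_erase hx]⟩⟩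
        · intro y
          obtain ⟨j, hj, h⟩ := hdom y
          exact ⟨j, hj, fun z hz => h z (Finset.mem_of_mem_erase hz)⟩
        · simp only [Finset.card_erase_of_mem hx]
          have := Finset.card_pos.2 ⟨x, hx⟩
          omega
      · rw [e]
        refine ⟨⟨?_, by simp [hi0], ?_, ?_⟩, Or.inr ⟨i, by simp, by simp [Finset.erase_insert hi]⟩⟩
        · intro y
          obtain ⟨j, hj, h⟩ := hdom y
          exact ⟨j, Finset.mem_insert_of_mem hj, h⟩
        · simp only
          rw [himg, Finset.erase_insert_of_ne hii]
        · simp only [Finset.card_insert_of_notMem hi]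
          omega
  simp only [key]
  by_cases hi0 : i0 ∈ C
  swap
  · left
    rintro d (⟨x, hx, h, _⟩ | ⟨i, hi, h, _⟩) <;> exact hi0 h
  have hcC := Finset.card_pos.2 ⟨i0, hi0⟩
  by_cases hT2 : ∃ i, i ∉ C ∧ i ≠ i0 ∧ σ.image c = insert i (C.erase i0)
  · right
    obtain ⟨i, hi, hii, himg⟩ := hT2
    have hinj : Set.InjOn c σ := by
      rw [← Finset.card_image_iff, himg, Finset.card_insert_of_notMem (by simp [hi]),
        Finset.card_erase_of_mem hi0]
      omega
    have : i ∈ σ.image c := by rw [himg]; simp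
    obtain ⟨x, hx, hxi⟩ := Finset.mem_image.1 this
    refine ⟨(σ.erase x, C), (σ, insert i C), ?_, fun d => ⟨?_, ?_⟩⟩
    · intro e
      have : C = insert i C := congrArg Prod.snd e
      rw [this] at hi
      simp at hi
    · rintro (⟨x', hx', _, himg', e⟩ | ⟨i', hi', _, hii', himg', e⟩)
      · left
        have : x' = x := by
          by_contra hne
          have h1 : i ∈ (σ.erase x').image c :=
            Finset.mem_image.2 ⟨x, Finset.mem_erase.2 ⟨fun h => hne h.symm, hx⟩, hxi⟩
          rw [himg'] at h1
          exact hi (Finset.mem_of_mem_erase h1)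
        rw [e, this]
      · right
        have h1 : i' ∈ insert i (C.erase i0) := by rw [← himg, himg']; simp
        rcases Finset.mem_insert.1 h1 with h | h
        · rw [e, h]
        · exact absurd (Finset.mem_of_mem_erase h) hi'
    · rintro (e | e)
      · refine Or.inl ⟨x, hx, hi0, ?_, e⟩
        ext j
        simp only [Finset.mem_image, Finset.mem_erase]
        constructor
        · rintro ⟨z, ⟨hzx, hz⟩, rfl⟩
          have h1 : c z ∈ insert i (C.erase i0) := by
            rw [← himg]; exact Finset.mem_image_of_mem c hz
          rcases Finset.mem_insert.1 h1 with h | h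
          · exact absurd (hinj hz hx (h.trans hxi.symm)) hzx
          · exact Finset.mem_erase.1 h
        · intro hj
          have h1 : j ∈ σ.image c := by
            rw [himg]; exact Finset.mem_insert_of_mem (Finset.mem_erase.2 hj)
          obtain ⟨z, hz, rfl⟩ := Finset.mem_image.1 h1
          refine ⟨z, ⟨?_, hz⟩, rfl⟩
          rintro rfl
          rw [hxi] at hj
          exact hi hj.2
      · exact Or.inr ⟨i, hi, hi0, hii, himg, e⟩
  · by_cases hT1 : ∃ x ∈ σ, (σ.erase x).image c = C.erase i0
    swap
    · left
      rintro d (⟨x, hx, _, h, _⟩ | ⟨i, hi, _, hii, himg, _⟩)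
      · exact hT1 ⟨x, hx, h⟩
      · exact hT2 ⟨i, hi, hii, himg⟩
    right
    have hinj : ∀ x ∈ σ, (σ.erase x).image c = C.erase i0 →
        Set.InjOn c (σ.erase x : Finset T) := by
      intro x hx h
      rw [← Finset.card_image_iff, h, Finset.card_erase_of_mem hi0, Finset.card_erase_of_mem hx,
        hcard]
    obtain ⟨x, hx, hximg⟩ := hT1
    have hσimg : σ.image c = insert (c x) (C.erase i0) := by
      rw [← hximg, ← Finset.image_insert, Finset.insert_erase hx]
    have hcx0 : c x ≠ i0 := by
      intro h
      rw [h, Finset.insert_erase hi0] at hσimg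
      exact hcol hσimg
    have hcxC : c x ∈ C := by
      by_contra h
      exact hT2 ⟨c x, h, hcx0, hσimg⟩
    have : c x ∈ (σ.erase x).image c := by
      rw [hximg]; exact Finset.mem_erase.2 ⟨hcx0, hcxC⟩
    obtain ⟨x', hx', hcx'⟩ := Finset.mem_image.1 this
    obtain ⟨hx'x, hx'σ⟩ := Finset.mem_erase.1 hx'
    have hx'img : (σ.erase x').image c = C.erase i0 := by
      rw [← hximg]
      ext j
      simp only [Finset.mem_image, Finset.mem_erase]
      constructor
      · rintro ⟨z, ⟨hz', hz⟩, rfl⟩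
        by_cases h : z = x
        · subst h
          exact ⟨x', ⟨hx'x, hx'σ⟩, hcx'⟩
        · exact ⟨z, ⟨h, hz⟩, rfl⟩
      · rintro ⟨z, ⟨hz', hz⟩, rfl⟩
        by_cases h : z = x'
        · subst h
          exact ⟨x, ⟨hx'x.symm, hx⟩, hcx'.symm⟩
        · exact ⟨z, ⟨h, hz⟩, rfl⟩
    refine ⟨(σ.erase x, C), (σ.erase x', C), ?_, fun d => ⟨?_, ?_⟩⟩
    · intro e
      have e' : σ.erase x = σ.erase x' := congrArg Prod.fst e
      rw [e'] at hx'
      simp at hx'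
    · rintro (⟨z, hz, _, himg', e⟩ | ⟨i', hi', _, hii', himg', e⟩)
      · by_cases h : z = x
        · left; rw [e, h]
        · by_cases h' : z = x'
          · right; rw [e, h']
          · exact absurd (hinj z hz himg' (by simp [hx'σ, Ne.symm h']) (by simp [hx, Ne.symm h])
              hcx') hx'x
      · exact absurd ⟨i', hi', hii', himg'⟩ hT2
    · rintro (e | e)
      · exact Or.inl ⟨x, hx, hi0, hximg, e⟩
      · exact Or.inl ⟨x', hx'σ, hi0, hx'img, e⟩

/-- Scarf lemma. -/
theorem scarf [Fintype T] [Fintype I] [Nonempty T] [Nonempty I] (r : I → T → ℕ)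
    (hr : ∀ i, Function.Injective (r i)) (c : T → I) :
    ∃ (σ : Finset T) (C : Finset I), Dom r σ C ∧ σ.image c = C := by
  classical
  by_contra hno
  push Not at hno
  obtain ⟨i0⟩ := ‹Nonempty I›
  let D : Finset (Finset T × Finset I) := Finset.univ.filter (Door r c i0)
  let R : Finset (Finset T × Finset I) := Finset.univ.filter (Room r)
  have hdc := Finset.sum_card_bipartiteAbove_eq_sum_card_bipartiteBelow (s := D) (t := R) Inc
  have hR : Even (∑ ρ ∈ R, (D.bipartiteBelow Inc ρ).card) := by
    apply Finset.even_sum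
    intro ρ hρ
    have hρ' : Room r ρ := (Finset.mem_filter.1 hρ).2
    rcases room_even r c i0 ρ hρ' (hno _ _ hρ'.1) with h | ⟨d₁, d₂, hne, h⟩
    · have : D.bipartiteBelow Inc ρ = ∅ := by
        ext d
        simp only [Finset.mem_bipartiteBelow, D, Finset.mem_filter, Finset.mem_univ, true_and]
        simpa using h d
      rw [this]; simp
    · have : D.bipartiteBelow Inc ρ = {d₁, d₂} := by
        ext d
        simp only [Finset.mem_bipartiteBelow, D, Finset.mem_filter, Finset.mem_univ, true_and]
        simpa using h d
      rw [this, Finset.card_pair hne]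
      exact even_two
  have hout : ((∅ : Finset T), ({i0} : Finset I)) ∈ D := by
    simp only [D, Finset.mem_filter, Finset.mem_univ, true_and]
    refine ⟨fun y => ⟨i0, by simp⟩, by simp, by simp, by simp⟩
  have hDD : Odd (∑ d ∈ D, (R.bipartiteAbove Inc d).card) := by
    rw [← Finset.add_sum_erase D _ hout]
    apply Odd.add_even
    · obtain ⟨ρ₁, h⟩ := door_one r hr i0
      have : R.bipartiteAbove Inc ((∅ : Finset T), ({i0} : Finset I)) = {ρ₁} := by
        ext ρ
        simp only [Finset.mem_bipartiteAbove, R, Finset.mem_filter, Finset.mem_univ, true_and]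
        simpa using h ρ
      rw [this]; simp
    · apply Finset.even_sum
      rintro ⟨σ, C⟩ hd
      obtain ⟨hne, hd⟩ := Finset.mem_erase.1 hd
      have hd' : Door r c i0 (σ, C) := (Finset.mem_filter.1 hd).2
      obtain ⟨hdom, hi0, himg, hcard⟩ := hd'
      simp only at hdom hi0 himg hcard
      have hσ : σ.Nonempty := by
        rw [Finset.nonempty_iff_ne_empty]
        rintro rfl
        apply hne
        have h1 : C.card = 1 := by simpa using hcard.symm
        obtain ⟨a, rfl⟩ := Finset.card_eq_one.1 h1
        simp only [Finset.mem_singleton] at hi0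
        rw [hi0]
      obtain ⟨ρ₁, ρ₂, hne, h⟩ := door_two r hr σ C hσ hdom hcard
      have : R.bipartiteAbove Inc (σ, C) = {ρ₁, ρ₂} := by
        ext ρ
        simp only [Finset.mem_bipartiteAbove, R, Finset.mem_filter, Finset.mem_univ, true_and]
        simpa using h ρ
      rw [this, Finset.card_pair hne]
      exact even_two
  rw [hdc] at hDD
  exact (Nat.not_even_iff_odd.2 hDD) hR

end

end ScarfLemma

namespace BrouwerSimplex

section
variable {I : Type*} [Fintype I] [DecidableEq I]

/-- Grid points of the simplex. -/
abbrev Grid (I : Type*) [Fintype I] (m : ℕ) : Type _ :=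
  {k : I → Fin (m + 1) // ∑ i, ((k i : Fin (m + 1)) : ℕ) = m}

theorem mkGrid (m : ℕ) (k : I → ℕ) (hk : ∑ i, k i = m) :
    ∃ g : Grid I m, ∀ i, ((g.1 i : Fin (m + 1)) : ℕ) = k i := by
  have h : ∀ i, k i < m + 1 := by
    intro i
    have := Finset.single_le_sum (f := k) (fun _ _ => Nat.zero_le _) (Finset.mem_univ i)
    omega
  exact ⟨⟨fun i => ⟨k i, h i⟩, hk⟩, fun i => rfl⟩

theorem grid_scarf [Nonempty I] (m : ℕ) (c : Grid I m → I) :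
    ∃ b : I → ℕ, ∃ x : Grid I m, (∀ i, b i ≤ x.1 i ∧ (x.1 i : ℕ) ≤ b i + Fintype.card I) ∧
      ∀ i, (x.1 i : ℕ) ≤ Fintype.card I ∨ ∃ x' : Grid I m, c x' = i ∧
        ∀ j, b j ≤ x'.1 j ∧ (x'.1 j : ℕ) ≤ b j + Fintype.card I := by
  classical
  obtain ⟨i0⟩ := ‹Nonempty I›
  have hT : Nonempty (Grid I m) := by
    obtain ⟨g, -⟩ := mkGrid m (fun i => if i = i0 then m else 0) (by simp)
    exact ⟨g⟩
  set N := Fintype.card (Grid I m) with hN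
  let e := Fintype.equivFin (Grid I m)
  let r : I → Grid I m → ℕ := fun i x => (x.1 i : ℕ) * N + (e x : ℕ)
  have hrle : ∀ i x y, r i y ≤ r i x → (y.1 i : ℕ) ≤ x.1 i := by
    intro i x y h
    by_contra! hlt
    have h1 : ((x.1 i : ℕ) + 1) * N ≤ (y.1 i : ℕ) * N := Nat.mul_le_mul_right _ hlt
    have h2 : (e x : ℕ) < N := (e x).2
    have h3 : (x.1 i : ℕ) * N + (e x : ℕ) ≥ (y.1 i : ℕ) * N + (e y : ℕ) := h
    rw [add_mul, one_mul] at h1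
    omega
  have hr : ∀ i, Function.Injective (r i) := by
    intro i x y h
    have h1 : (x.1 i : ℕ) = y.1 i := le_antisymm (hrle i y x h.le) (hrle i x y h.ge)
    have h3 : (x.1 i : ℕ) * N + (e x : ℕ) = (y.1 i : ℕ) * N + (e y : ℕ) := h
    rw [h1] at h3
    exact e.injective (Fin.ext (by omega))
  have : Nonempty I := ⟨i0⟩
  obtain ⟨σ, C, hdom, himg⟩ := ScarfLemma.scarf r hr c
  obtain ⟨j0, hj0⟩ : C.Nonempty := by
    obtain ⟨g⟩ := hT
    obtain ⟨j, hj, _⟩ := hdom g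
    exact ⟨j, hj⟩
  have hσ : σ.Nonempty := by
    rw [← himg] at hj0
    exact Finset.Nonempty.of_image ⟨j0, hj0⟩
  choose mn hmσ hmin using fun i => σ.exists_min_image (fun x : Grid I m => (x.1 i : ℕ)) hσ
  let b : I → ℕ := fun i => if i ∈ C then ((mn i).1 i : ℕ) else 0
  let b' : I → ℕ := fun i => if i ∈ C then ((mn i).1 i : ℕ) + 1 else 0
  have hb' : m < ∑ i, b' i := by
    by_contra! hle
    obtain ⟨g, hg⟩ := mkGrid m (fun i => b' i + if i = j0 then m - ∑ i, b' i else 0) (by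
      rw [Finset.sum_add_distrib]
      simp only [Finset.sum_ite_eq', Finset.mem_univ, if_true]
      omega)
    obtain ⟨j, hj, h⟩ := hdom g
    have h1 := hrle j _ _ (h _ (hmσ j))
    rw [hg j] at h1
    simp only [b', hj, if_true] at h1
    omega
  have hbb : ∑ i, b' i ≤ ∑ i, b i + Fintype.card I := by
    have : ∑ i, b' i ≤ ∑ i, (b i + 1) := by
      apply Finset.sum_le_sum
      intro i _
      simp only [b, b']
      split_ifs <;> omega
    rw [Finset.sum_add_distrib] at this
    simpa using this
  have hall : ∀ x ∈ σ, ∀ i, b i ≤ x.1 i ∧ (x.1 i : ℕ) ≤ b i + Fintype.card I := by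
    intro x hx
    have h1 : ∀ i, b i ≤ x.1 i := by
      intro i
      simp only [b]
      split_ifs
      · exact hmin i x hx
      · exact Nat.zero_le _
    intro i
    refine ⟨h1 i, ?_⟩
    have h2 : ∑ i, ((x.1 i : ℕ) - b i) + ∑ i, b i = m := by
      rw [← Finset.sum_add_distrib]
      refine Eq.trans ?_ x.2
      apply Finset.sum_congr rfl
      intro i _
      have := h1 i
      omega
    have h3 := Finset.single_le_sum (f := fun i => (x.1 i : ℕ) - b i)
      (fun _ _ => Nat.zero_le _) (Finset.mem_univ i)
    omega
  obtain ⟨x, hx⟩ := hσ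
  refine ⟨b, x, hall x hx, fun i => ?_⟩
  by_cases hi : i ∈ C
  · right
    rw [← himg] at hi
    obtain ⟨x', hx', e'⟩ := Finset.mem_image.1 hi
    exact ⟨x', e', hall x' hx'⟩
  · left
    have := (hall x hx i).2
    simpa [b, hi] using this

theorem approx [Nonempty I] (f : (I → ℝ) → (I → ℝ))
    (hmaps : ∀ x ∈ stdSimplex ℝ I, f x ∈ stdSimplex ℝ I) (m : ℕ) (hm : 0 < m) :
    ∃ x ∈ stdSimplex ℝ I, ∀ i, ∃ x' ∈ stdSimplex ℝ I,
      (∀ j, |x' j - x j| ≤ (Fintype.card I : ℝ) / m) ∧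
      x' i ≤ f x' i + (Fintype.card I : ℝ) / m := by
  have hm' : (0 : ℝ) < m := by exact_mod_cast hm
  let p : Grid I m → (I → ℝ) := fun k i => ((k.1 i : ℕ) : ℝ) / m
  have hp : ∀ k, p k ∈ stdSimplex ℝ I := by
    intro k
    refine ⟨fun i => by positivity, ?_⟩
    simp only [p]
    rw [← Finset.sum_div, ← Nat.cast_sum, k.2, div_self hm'.ne']
  have hcol : ∀ k : Grid I m, ∃ i, p k i ≤ f (p k) i := by
    intro k
    by_contra! h
    have h1 : ∑ i, f (p k) i < ∑ i, p k i :=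
      Finset.sum_lt_sum_of_nonempty Finset.univ_nonempty (fun i _ => h i)
    rw [(hp k).2, (hmaps _ (hp k)).2] at h1
    exact lt_irrefl _ h1
  choose c hc using hcol
  obtain ⟨b, x, hx, h⟩ := grid_scarf m c
  have habs : ∀ x' : Grid I m, (∀ j, b j ≤ x'.1 j ∧ (x'.1 j : ℕ) ≤ b j + Fintype.card I) →
      ∀ j, |p x' j - p x j| ≤ (Fintype.card I : ℝ) / m := by
    intro x' hx' j
    simp only [p]
    rw [← sub_div, abs_div, abs_of_pos hm']
    gcongr
    obtain ⟨h1, h2⟩ := hx j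
    obtain ⟨h3, h4⟩ := hx' j
    have h1' : (b j : ℝ) ≤ ((x.1 j : ℕ) : ℝ) := by exact_mod_cast h1
    have h2' : ((x.1 j : ℕ) : ℝ) ≤ b j + Fintype.card I := by exact_mod_cast h2
    have h3' : (b j : ℝ) ≤ ((x'.1 j : ℕ) : ℝ) := by exact_mod_cast h3
    have h4' : ((x'.1 j : ℕ) : ℝ) ≤ b j + Fintype.card I := by exact_mod_cast h4
    rw [abs_le]
    constructor <;> linarith
  refine ⟨p x, hp x, fun i => ?_⟩
  rcases h i with h | ⟨x', hci, hx'⟩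
  · refine ⟨p x, hp x, habs x hx, ?_⟩
    have h0 : 0 ≤ f (p x) i := (hmaps _ (hp x)).1 i
    have : p x i ≤ (Fintype.card I : ℝ) / m := by
      simp only [p]
      gcongr
    linarith
  · refine ⟨p x', hp x', habs x' hx', ?_⟩
    have h1 := hc x'
    rw [hci] at h1
    have : (0 : ℝ) ≤ (Fintype.card I : ℝ) / m := by positivity
    linarith

/-- Brouwer fixed point theorem for the standard simplex. -/
theorem brouwer [Nonempty I] (f : (I → ℝ) → (I → ℝ)) (hf : ContinuousOn f (stdSimplex ℝ I))
    (hmaps : ∀ x ∈ stdSimplex ℝ I, f x ∈ stdSimplex ℝ I) :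
    ∃ x ∈ stdSimplex ℝ I, f x = x := by
  choose x hx x' hx' hdist hle using fun m : ℕ => approx f hmaps (m + 1) (Nat.succ_pos m)
  obtain ⟨z, hz, φ, hφ, hlim⟩ := (isCompact_stdSimplex ℝ I).tendsto_subseq hx
  have h0 : Tendsto (fun m : ℕ => (Fintype.card I : ℝ) / ((m + 1 : ℕ) : ℝ)) atTop (𝓝 0) :=
    (tendsto_const_div_atTop_nhds_zero_nat (Fintype.card I : ℝ)).comp (tendsto_add_atTop_nat 1)
  have h0φ := h0.comp hφ.tendsto_atTop
  have hge : ∀ i, z i ≤ f z i := by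
    intro i
    have hlim' : Tendsto (fun m => x' (φ m) i) atTop (𝓝 z) := by
      rw [tendsto_pi_nhds] at hlim ⊢
      intro j
      have h1 : Tendsto (fun m => x' (φ m) i j - x (φ m) j) atTop (𝓝 0) :=
        squeeze_zero_norm (fun m => hdist (φ m) i j) h0φ
      have h2 := h1.add (hlim j)
      simpa using h2
    have hfl : Tendsto (fun m => f (x' (φ m) i)) atTop (𝓝 (f z)) :=
      (hf z hz).tendsto.comp (tendsto_nhdsWithin_iff.2 ⟨hlim', Eventually.of_forall
        fun m => hx' (φ m) i⟩)
    have h3 := (tendsto_pi_nhds.1 hlim') i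
    have h4 := ((tendsto_pi_nhds.1 hfl) i).add h0φ
    rw [add_zero] at h4
    exact le_of_tendsto_of_tendsto' h3 h4 (fun m => hle (φ m) i)
  refine ⟨z, hz, ?_⟩
  have hs : ∑ i, z i = ∑ i, f z i := by rw [hz.2, (hmaps z hz).2]
  rw [Finset.sum_eq_sum_iff_of_le (fun i _ => hge i)] at hs
  funext i
  exact (hs i (Finset.mem_univ i)).symm

end

end BrouwerSimplex

namespace BestApprox

section
variable {E : Type*} [NormedAddCommGroup E] [NormedSpace ℝ E]

theorem near_min [UniformConvexSpace E] (X : Set E) (hcv : Convex ℝ X) (y : E) (ε : ℝ)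
    (hε : 0 < ε) : ∃ η : ℝ, 0 < η ∧ ∀ a ∈ X, ∀ b ∈ X, ‖y - a‖ ≤ Metric.infDist y X + η →
      ‖y - b‖ ≤ Metric.infDist y X + η → ‖a - b‖ < ε := by
  set d := Metric.infDist y X with hd
  have hd0 : 0 ≤ d := Metric.infDist_nonneg
  rcases hd0.eq_or_lt with h0 | hpos
  · refine ⟨ε / 3, by positivity, fun a _ b _ ha hb => ?_⟩
    have : ‖a - b‖ ≤ ‖y - a‖ + ‖y - b‖ := by
      have : a - b = (y - b) - (y - a) := by abel
      rw [this, add_comm]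
      exact norm_sub_le _ _
    linarith
  · obtain ⟨δ, hδ, H⟩ := exists_forall_closed_ball_dist_add_le_two_sub E
      (show 0 < ε / (d + 1) by positivity)
    refine ⟨min 1 (d * δ / 4), by positivity, fun a ha b hb hya hyb => ?_⟩
    by_contra! hab
    set η := min 1 (d * δ / 4) with hη
    have hη0 : 0 < η := by positivity
    have hη1 : η ≤ 1 := min_le_left _ _
    have hη2 : η ≤ d * δ / 4 := min_le_right _ _
    set r := d + η with hr
    have hr0 : 0 < r := by positivity
    have h1 : ∀ v : E, ‖v‖ ≤ r → ‖r⁻¹ • v‖ ≤ 1 := by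
      intro v hv
      rw [norm_smul, norm_inv, Real.norm_of_nonneg hr0.le, inv_mul_le_iff₀ hr0, mul_one]
      exact hv
    have h2 := H (h1 _ hya) (h1 _ hyb) (by
      rw [← smul_sub, norm_smul, norm_inv, Real.norm_of_nonneg hr0.le, sub_sub_sub_cancel_left,
        norm_sub_rev, div_eq_inv_mul]
      gcongr
      linarith)
    rw [← smul_add, norm_smul, norm_inv, Real.norm_of_nonneg hr0.le, inv_mul_le_iff₀ hr0] at h2
    have hmid : (1 / 2 : ℝ) • a + (1 / 2 : ℝ) • b ∈ X :=
      hcv ha hb (by norm_num) (by norm_num) (by norm_num)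
    have h3 : d ≤ ‖y - ((1 / 2 : ℝ) • a + (1 / 2 : ℝ) • b)‖ := by
      rw [← dist_eq_norm]
      exact Metric.infDist_le_dist_of_mem hmid
    have h4 : y - ((1 / 2 : ℝ) • a + (1 / 2 : ℝ) • b) = (1 / 2 : ℝ) • ((y - a) + (y - b)) := by
      module
    rw [h4, norm_smul, Real.norm_of_nonneg (by norm_num)] at h3
    nlinarith [mul_pos hη0 hδ, mul_pos hpos hδ]

theorem exists_proj [UniformConvexSpace E] [CompleteSpace E] (X : Set E) (hne : X.Nonempty)
    (hcl : IsClosed X) (hcv : Convex ℝ X) :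
    ∃ P : E → E, Continuous P ∧ (∀ y, P y ∈ X) ∧ ∀ y, ∀ w ∈ X, ‖y - P y‖ ≤ ‖y - w‖ := by
  have hex : ∀ y, ∃ a ∈ X, ‖y - a‖ ≤ Metric.infDist y X := by
    intro y
    have hseq : ∀ n : ℕ, ∃ a ∈ X, ‖y - a‖ < Metric.infDist y X + 1 / ((n : ℝ) + 1) := by
      intro n
      have h1 : Metric.infDist y X < Metric.infDist y X + 1 / ((n : ℝ) + 1) :=
        lt_add_of_pos_right _ (by positivity)
      obtain ⟨a, ha, h⟩ := (Metric.infDist_lt_iff hne).1 h1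
      exact ⟨a, ha, by rwa [← dist_eq_norm]⟩
    choose a ha hlt using hseq
    have hC : CauchySeq a := by
      rw [Metric.cauchySeq_iff]
      intro ε hε
      obtain ⟨η, hη, H⟩ := near_min X hcv y ε hε
      obtain ⟨N, hN⟩ := exists_nat_one_div_lt hη
      refine ⟨N, fun m hm n hn => ?_⟩
      rw [dist_eq_norm]
      have hk : ∀ k ≥ N, ‖y - a k‖ ≤ Metric.infDist y X + η := by
        intro k hk
        have : 1 / ((k : ℝ) + 1) ≤ 1 / ((N : ℝ) + 1) := one_div_le_one_div_of_le (by positivity)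
          (by have : (N : ℝ) ≤ k := by exact_mod_cast hk
              linarith)
        linarith [hlt k]
      exact H _ (ha m) _ (ha n) (hk m hm) (hk n hn)
    obtain ⟨l, hl⟩ := cauchySeq_tendsto_of_complete hC
    refine ⟨l, hcl.mem_of_tendsto hl (Eventually.of_forall ha), ?_⟩
    have h1 : Tendsto (fun n => ‖y - a n‖) atTop (𝓝 ‖y - l‖) := (hl.const_sub y).norm
    have h2 : Tendsto (fun n : ℕ => Metric.infDist y X + 1 / ((n : ℝ) + 1)) atTop
        (𝓝 (Metric.infDist y X + 0)) := tendsto_one_div_add_atTop_nhds_zero_nat.const_add _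
    rw [add_zero] at h2
    exact le_of_tendsto_of_tendsto' h1 h2 (fun n => (hlt n).le)
  choose P hP hPd using hex
  refine ⟨P, ?_, hP, fun y w hw => (hPd y).trans ?_⟩
  · rw [Metric.continuous_iff]
    intro y ε hε
    obtain ⟨η, hη, H⟩ := near_min X hcv y ε hε
    refine ⟨η / 2, by positivity, fun y' hy' => ?_⟩
    rw [dist_eq_norm]
    refine H _ (hP y') _ (hP y) ?_ ((hPd y).trans (by linarith))
    have h1 : ‖y - P y'‖ ≤ ‖y - y'‖ + ‖y' - P y'‖ := by
      have : y - P y' = (y - y') + (y' - P y') := by abel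
      rw [this]
      exact norm_add_le _ _
    have h2 : Metric.infDist y' X ≤ Metric.infDist y X + dist y' y :=
      Metric.infDist_le_infDist_add_dist
    rw [norm_sub_rev y y', ← dist_eq_norm y' y] at h1
    linarith [hPd y']
  · rw [← dist_eq_norm]
    exact Metric.infDist_le_dist_of_mem hw

theorem kakutani_approx (K : Set E) (hK : IsCompact K) (hKc : Convex ℝ K) (hKne : K.Nonempty)
    (G : E → Set E) (hGne : ∀ y ∈ K, (G y).Nonempty) (hGK : ∀ y ∈ K, G y ⊆ K)
    (ε : ℝ) (hε : 0 < ε) :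
    ∃ y ∈ K, ∀ s : Set E, Convex ℝ s → (∀ a ∈ K, dist y a < ε → G a ⊆ s) → y ∈ s := by
  classical
  obtain ⟨t, htK, htf, hcov⟩ := hK.finite_cover_balls hε
  have : Fintype t := htf.fintype
  have htne : Nonempty t := by
    obtain ⟨y, hy⟩ := hKne
    obtain ⟨a, ha, _⟩ := Set.mem_iUnion₂.1 (hcov hy)
    exact ⟨⟨a, ha⟩⟩
  choose b hb using fun a : t => hGne a (htK a.2)
  have hbK : ∀ a, b a ∈ K := fun a => hGK a (htK a.2) (hb a)
  let L : (t → ℝ) → E := fun τ => ∑ a, τ a • b a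
  have hL : Continuous L := by fun_prop
  have hLK : ∀ τ ∈ stdSimplex ℝ t, L τ ∈ K := fun τ hτ =>
    hKc.sum_mem (fun a _ => hτ.1 a) hτ.2 (fun a _ => hbK a)
  let w : t → E → ℝ := fun a y => max 0 (ε - dist y a)
  have hw : ∀ a, Continuous (w a) := fun a => by fun_prop
  have hw0 : ∀ a y, 0 ≤ w a y := fun a y => le_max_left _ _
  let S : E → ℝ := fun y => ∑ a, w a y
  have hS : Continuous S := by fun_prop
  have hSpos : ∀ y ∈ K, 0 < S y := by
    intro y hy
    obtain ⟨a, ha, hya⟩ := Set.mem_iUnion₂.1 (hcov hy)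
    refine Finset.sum_pos' (fun a _ => hw0 a y) ⟨⟨a, ha⟩, Finset.mem_univ _, ?_⟩
    have : dist y a < ε := hya
    exact lt_max_of_lt_right (by simpa using this)
  obtain ⟨τ, hτ, hfix⟩ := BrouwerSimplex.brouwer (I := t)
    (fun τ a => w a (L τ) / S (L τ))
    (by
      apply continuousOn_pi.2
      intro a
      exact ((hw a).comp hL).continuousOn.div (hS.comp hL).continuousOn
        (fun τ hτ => (hSpos _ (hLK τ hτ)).ne'))
    (by
      intro τ hτ
      refine ⟨fun a => div_nonneg (hw0 _ _) (hSpos _ (hLK τ hτ)).le, ?_⟩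
      rw [← Finset.sum_div]
      exact div_self (hSpos _ (hLK τ hτ)).ne')
  refine ⟨L τ, hLK τ hτ, fun s hs h => ?_⟩
  have hsum : ∑ᶠ a, τ a • b a ∈ s := by
    refine hs.finsum_mem hτ.1 (by rw [finsum_eq_sum_of_fintype]; exact hτ.2) ?_
    intro a ha
    refine h a (htK a.2) ?_ (hb a)
    by_contra! hd
    apply ha
    rw [← congrFun hfix a]
    have : w a (L τ) = 0 := max_eq_left (by linarith)
    simp only [this, zero_div]
  rwa [finsum_eq_sum_of_fintype] at hsum

/-- Kakutani Fan Glicksberg theorem in a normed space. -/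
theorem kakutani (K : Set E) (hK : IsCompact K) (hKc : Convex ℝ K) (hKne : K.Nonempty)
    (G : E → Set E) (hGne : ∀ y ∈ K, (G y).Nonempty) (hGK : ∀ y ∈ K, G y ⊆ K)
    (hGc : ∀ y ∈ K, Convex ℝ (G y))
    (hG : ∀ (y z : ℕ → E) (y0 z0 : E), (∀ n, y n ∈ K) → y0 ∈ K → (∀ n, z n ∈ G (y n)) →
      Tendsto y atTop (𝓝 y0) → Tendsto z atTop (𝓝 z0) → z0 ∈ G y0) :
    ∃ y ∈ K, y ∈ G y := by
  choose y hyK hy using fun n : ℕ => kakutani_approx K hK hKc hKne G hGne hGK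
    (1 / ((n : ℝ) + 1)) (by positivity)
  obtain ⟨y0, hy0, φ, hφ, hlim⟩ := hK.tendsto_subseq hyK
  refine ⟨y0, hy0, ?_⟩
  have hcl : IsClosed (G y0) := by
    apply IsSeqClosed.isClosed
    intro z z0 hz hz0
    exact hG (fun _ => y0) z y0 z0 (fun _ => hy0) hy0 hz tendsto_const_nhds hz0
  have husc : ∀ δ > 0, ∃ ρ > 0, ∀ a ∈ K, dist a y0 < ρ → G a ⊆ Metric.thickening δ (G y0) := by
    intro δ hδ
    by_contra! hcon
    choose a haK had hna using fun n : ℕ => hcon (1 / ((n : ℝ) + 1)) (by positivity)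
    choose z hz hzn using fun n => Set.not_subset.1 (hna n)
    obtain ⟨z0, hz0, ψ, hψ, hzlim⟩ := hK.tendsto_subseq (fun n => hGK _ (haK n) (hz n))
    have halim : Tendsto a atTop (𝓝 y0) := by
      rw [tendsto_iff_dist_tendsto_zero]
      exact squeeze_zero (fun _ => dist_nonneg) (fun n => (had n).le)
        tendsto_one_div_add_atTop_nhds_zero_nat
    have h1 : z0 ∈ G y0 := hG (a ∘ ψ) (z ∘ ψ) y0 z0 (fun n => haK _) hy0 (fun n => hz _)
      (halim.comp hψ.tendsto_atTop) hzlim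
    have h2 : z0 ∈ Metric.thickening δ (G y0) := Metric.self_subset_thickening hδ _ h1
    have h3 := hzlim.eventually (Metric.isOpen_thickening.mem_nhds h2)
    obtain ⟨n, hn⟩ := h3.exists
    exact hzn _ hn
  rw [← hcl.closure_eq, Metric.closure_eq_iInter_cthickening]
  refine Set.mem_iInter₂.2 fun δ hδ => ?_
  obtain ⟨ρ, hρ, H⟩ := husc δ hδ
  refine Metric.closure_thickening_subset_cthickening _ _ ?_
  refine mem_closure_of_tendsto hlim ?_
  have e1 : ∀ᶠ n in atTop, dist ((y ∘ φ) n) y0 < ρ / 2 :=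
    (tendsto_iff_dist_tendsto_zero.1 hlim).eventually (gt_mem_nhds (by positivity))
  have e2 : ∀ᶠ n in atTop, 1 / ((φ n : ℝ) + 1) < ρ / 2 :=
    (tendsto_one_div_add_atTop_nhds_zero_nat.comp hφ.tendsto_atTop).eventually
      (gt_mem_nhds (by positivity))
  filter_upwards [e1, e2] with n h1 h2
  refine hy (φ n) _ ((hGc y0 hy0).thickening δ) fun a ha had => H a ha ?_
  have h4 : dist a y0 ≤ dist (y (φ n)) a + dist (y (φ n)) y0 := dist_triangle_left _ _ _
  have h1' : dist (y (φ n)) y0 < ρ / 2 := h1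
  linarith

end

end BestApprox

/-- Existence of a best approximate solution for a GNEP with non-self constraint maps
over uniformly convex Banach spaces (Corollary of the main theorem). -/
theorem stmt19 {ι : Type*} [Fintype ι] [DecidableEq ι]
    {Y : ι → Type*} [∀ i, NormedAddCommGroup (Y i)] [∀ i, NormedSpace ℝ (Y i)]
    [∀ i, UniformConvexSpace (Y i)] [∀ i, CompleteSpace (Y i)]
    (X : ∀ i, Set (Y i)) (hXne : ∀ i, (X i).Nonempty)
    (hXcl : ∀ i, IsClosed (X i)) (hXcv : ∀ i, Convex ℝ (X i))
    (u : ∀ i, (∀ j, Y j) → ℝ)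
    (F : ∀ i, (∀ j, Y j) → Set (Y i))
    (hFindep : ∀ i x z, F i (Function.update x i z) = F i x)
    (huusc : ∀ i, UpperSemicontinuous (u i))
    (huqc : ∀ i, ∀ x : ∀ j, Y j, ∀ a b : Y i, ∀ t : ℝ, 0 ≤ t → t ≤ 1 →
      min (u i (Function.update x i a)) (u i (Function.update x i b)) ≤
        u i (Function.update x i (t • a + (1 - t) • b)))
    (hFusc : ∀ i, ∀ x ∈ profileSet X, ∀ W : Set (Y i), IsOpen W → F i x ⊆ W →
      ∀ᶠ x' in 𝓝[profileSet X] x, F i x' ⊆ W)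
    (hFne : ∀ i, ∀ x ∈ profileSet X, (F i x).Nonempty)
    (hFcl : ∀ i, ∀ x ∈ profileSet X, IsClosed (F i x))
    (hFcv : ∀ i, ∀ x ∈ profileSet X, Convex ℝ (F i x))
    (hFcpt : ∀ i, IsCompact (closure (⋃ x ∈ profileSet X, F i x)))
    (hFPT : ∀ i, ∀ x ∈ profileSet X, ∀ y ∈ F i x, ∀ ε : ℝ, 0 < ε →
      ∀ᶠ x' in 𝓝[profileSet X] x, ∃ y' ∈ F i x',
        u i (Function.update x i y) < u i (Function.update x' i y') + ε) :
    ∃ x ∈ profileSet X, ∃ y : ∀ i, Y i, ∀ i,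
      ‖y i - x i‖ = ⨅ w : X i, ‖y i - (w : Y i)‖ ∧
      y i ∈ F i x ∧
      ∀ z ∈ F i x, u i (Function.update x i z) ≤ u i (Function.update x i (y i)) := by
  classical
  choose P hPc hPX hPmin using fun i => BestApprox.exists_proj (X i) (hXne i) (hXcl i) (hXcv i)
  let PP : (∀ i, Y i) → (∀ i, Y i) := fun y i => P i (y i)
  have hPPc : Continuous PP := continuous_pi fun i => (hPc i).comp (continuous_apply i)
  have hPP : ∀ y, PP y ∈ profileSet X := fun y i => hPX i (y i)
  let K : ∀ i, Set (Y i) := fun i => closure (convexHull ℝ (⋃ x ∈ profileSet X, F i x))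
  have hKcpt : ∀ i, IsCompact (K i) := by
    intro i
    exact (((hFcpt i).totallyBounded.subset subset_closure).convexHull).closure.isCompact_of_isClosed
      isClosed_closure
  have hKcv : ∀ i, Convex ℝ (K i) := fun i => (convex_convexHull ℝ _).closure
  have hFU : ∀ i, ∀ x ∈ profileSet X, F i x ⊆ ⋃ x ∈ profileSet X, F i x :=
    fun i x hx => Set.subset_biUnion_of_mem (u := fun x => F i x) hx
  have hFK : ∀ i, ∀ x ∈ profileSet X, F i x ⊆ K i := fun i x hx =>
    (hFU i x hx).trans ((subset_convexHull ℝ _).trans subset_closure)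
  let M : ∀ i, (∀ j, Y j) → Set (Y i) := fun i x =>
    {z | z ∈ F i x ∧ ∀ w ∈ F i x, u i (Function.update x i w) ≤ u i (Function.update x i z)}
  have hMne : ∀ i, ∀ x ∈ profileSet X, (M i x).Nonempty := by
    intro i x hx
    have hc : IsCompact (F i x) :=
      (hFcpt i).of_isClosed_subset (hFcl i x hx) ((hFU i x hx).trans subset_closure)
    have hus : UpperSemicontinuous fun z => u i (Function.update x i z) :=
      (huusc i).comp (continuous_const.update i continuous_id)
    obtain ⟨z, hz, hmax⟩ := (hus.upperSemicontinuousOn (F i x)).exists_isMaxOn (hFne i x hx) hc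
    exact ⟨z, hz, fun w hw => hmax hw⟩
  have hMcv : ∀ i, ∀ x ∈ profileSet X, Convex ℝ (M i x) := by
    intro i x hx a ha b hb s t hs ht hst
    refine ⟨hFcv i x hx ha.1 hb.1 hs ht hst, fun w hw => ?_⟩
    have h := huqc i x a b s hs (by linarith)
    have ht' : 1 - s = t := by linarith
    rw [ht'] at h
    exact (le_min (ha.2 w hw) (hb.2 w hw)).trans h
  have hgraph : ∀ i (x : ℕ → ∀ j, Y j) (z : ℕ → Y i) (x0 : ∀ j, Y j) (z0 : Y i),
      (∀ n, x n ∈ profileSet X) → x0 ∈ profileSet X → (∀ n, z n ∈ M i (x n)) →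
      Tendsto x atTop (𝓝 x0) → Tendsto z atTop (𝓝 z0) → z0 ∈ M i x0 := by
    intro i x z x0 z0 hx hx0 hz hxl hzl
    have hxl' : Tendsto x atTop (𝓝[profileSet X] x0) :=
      tendsto_nhdsWithin_iff.2 ⟨hxl, Eventually.of_forall hx⟩
    refine ⟨?_, fun w hw => ?_⟩
    · by_contra hn
      obtain ⟨W, V, hW, hV, hFW, hzV, hdisj⟩  : SeparatedNhds (F i x0) {z0} :=
        separatedNhds_iff_disjoint.2 (by rw [nhdsSet_singleton (x := z0)]; exact RegularSpace.regular (hFcl i x0 hx0) hn)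
      have h1 := hxl'.eventually (hFusc i x0 hx0 W hW hFW)
      have h2 := hzl.eventually (hV.mem_nhds (hzV rfl))
      obtain ⟨n, h1, h2⟩ := (h1.and h2).exists
      exact Set.disjoint_left.1 hdisj (h1 (hz n).1) h2
    · refine le_of_forall_pos_le_add fun ε hε => ?_
      have h1 := hxl'.eventually (hFPT i x0 hx0 w hw (ε / 2) (by positivity))
      have hl : Tendsto (fun n => Function.update (x n) i (z n)) atTop
          (𝓝 (Function.update x0 i z0)) := hxl.update i hzl
      have h2 := hl.eventually (huusc i (Function.update x0 i z0)
        (u i (Function.update x0 i z0) + ε / 2) (by linarith))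
      obtain ⟨n, ⟨y', hy', hlt⟩, h2⟩ := (h1.and h2).exists
      have h3 := (hz n).2 y' hy'
      linarith
  obtain ⟨y, -, hy⟩ := BestApprox.kakutani (Set.pi Set.univ K) (isCompact_univ_pi hKcpt)
    (convex_pi fun i _ => hKcv i)
    (by
      have hne : ∀ i, (K i).Nonempty := fun i =>
        (hFne i _ (hPP 0)).mono (hFK i _ (hPP 0))
      exact Set.univ_pi_nonempty_iff.2 hne)
    (fun y => Set.pi Set.univ fun i => M i (PP y))
    (fun y _ => Set.univ_pi_nonempty_iff.2 fun i => hMne i _ (hPP y))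
    (fun y _ => Set.pi_mono fun i _ z hz => hFK i _ (hPP y) hz.1)
    (fun y _ => convex_pi fun i _ => hMcv i _ (hPP y))
    (by
      intro y z y0 z0 _ _ hz hyl hzl i _
      exact hgraph i (fun n => PP (y n)) (fun n => z n i) (PP y0) (z0 i) (fun n => hPP _) (hPP _)
        (fun n => hz n i (Set.mem_univ i)) ((hPPc.tendsto y0).comp hyl)
        ((tendsto_pi_nhds.1 hzl) i))
  refine ⟨PP y, hPP y, y, fun i => ⟨?_, (hy i (Set.mem_univ i)).1, (hy i (Set.mem_univ i)).2⟩⟩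
  have : Nonempty (X i) := (hXne i).to_subtype
  refine le_antisymm (le_ciInf fun w => hPmin i (y i) w w.2) ?_
  exact ciInf_le (f := fun w : X i => ‖y i - (w : Y i)‖)
    ⟨0, by rintro _ ⟨w, rfl⟩; exact norm_nonneg _⟩ ⟨PP y i, hPP y i⟩
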